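/- (1) For every c > c₀ there exists a unique real E such that E ≤ 0, −c₀ ≤ −c − E < −ã₁, and v(−E)·u'(−c−E) = u(−E)·v'(−c−E); this E (the rescaled upper edge E⁰_max of the first spectral band) satisfies −c + ã₁ < E < −c + c₀. (2) There exists C > 0 such that for every h in (0, c₀^(−3/2)) and E as in (1) with c = h^(−2/3), one has |E + h^(−2/3) − ã₁ − √3·α·(u'(−ã₁))²/ã₁ · exp(−4/(3h) + 2·ã₁·h^(−1/3))| ≤ C·h^(1/3)·exp(−4/(3h) + 2·ã₁·h^(−1/3)). -/

import Mathlib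

open Real Set

/-- Derivative of the standard Airy function `Ai` expressed in the basis of the
canonical solutions `u`, `v` of the Airy equation (given their derivatives `u'`, `v'`). -/
noncomputable def AiD (u' v' : ℝ → ℝ) (x : ℝ) : ℝ :=
  u' x / ((3:ℝ) ^ ((2:ℝ)/3) * Real.Gamma (2/3))
    - v' x / ((3:ℝ) ^ ((1:ℝ)/3) * Real.Gamma (1/3))

/-- `α = Γ(1/3)/(3^(1/3)·Γ(2/3)) = −Ai(0)/Ai'(0)`. -/
noncomputable def airyAlpha : ℝ :=
  Real.Gamma (1/3) / ((3:ℝ) ^ ((1:ℝ)/3) * Real.Gamma (2/3))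

/-! ### Moments of the kernel `exp (-(t³ + (x/t)³)/3)` -/

open MeasureTheory Filter Topology

/-- The kernel `exp (-(t³ + (x/t)³)/3)`, invariant under `t ↦ x/t`. -/
noncomputable def airyKernel (x t : ℝ) : ℝ := exp (-(t ^ 3 + (x / t) ^ 3) / 3)

/-- The `a`-th moment of `airyKernel x` on the positive half-line. -/
noncomputable def airyMoment (a x : ℝ) : ℝ := ∫ t in Ioi (0:ℝ), t ^ a * airyKernel x t

lemma airyKernel_pos (x t : ℝ) : 0 < airyKernel x t := exp_pos _

lemma measurable_rpow_mul_airyKernel (a x : ℝ) :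
    Measurable fun t : ℝ => t ^ a * airyKernel x t := by
  unfold airyKernel
  fun_prop

lemma airyKernel_anti {x y t : ℝ} (hx : 0 ≤ x) (hxy : x ≤ y) (ht : 0 < t) :
    airyKernel y t ≤ airyKernel x t := by
  unfold airyKernel
  have : (x / t) ^ 3 ≤ (y / t) ^ 3 := by gcongr
  exact exp_le_exp.2 (by linarith)

lemma airyKernel_div {x t : ℝ} (hx : 0 < x) (ht : 0 < t) :
    airyKernel x (x / t) = airyKernel x t := by
  unfold airyKernel
  congr 1
  field_simp
  ring

lemma airyKernel_zero_left (t : ℝ) : airyKernel 0 t = exp (-(1/3) * t ^ (3:ℝ)) := by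
  unfold airyKernel
  congr 1
  rw [show t ^ (3:ℝ) = t ^ 3 by exact_mod_cast rpow_natCast t 3]
  ring

lemma integrableOn_airyKernel_of_neg_one_lt {a x : ℝ} (ha : -1 < a) (hx : 0 ≤ x) :
    IntegrableOn (fun t => t ^ a * airyKernel x t) (Ioi 0) := by
  have h := integrableOn_rpow_mul_exp_neg_mul_rpow (p := 3) (b := 1/3) ha (by norm_num) (by norm_num)
  refine Integrable.mono' h (measurable_rpow_mul_airyKernel a x).aestronglyMeasurable ?_
  refine (ae_restrict_iff' measurableSet_Ioi).2 (.of_forall fun t (ht : 0 < t) => ?_)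
  have hk := airyKernel_pos x t
  rw [norm_of_nonneg (by positivity), ← airyKernel_zero_left]
  gcongr
  exact airyKernel_anti le_rfl hx ht

lemma image_div_Ioi {x : ℝ} (hx : 0 < x) : (fun t => x / t) '' Ioi (0:ℝ) = Ioi 0 := by
  ext s
  constructor
  · rintro ⟨t, ht, rfl⟩
    exact div_pos hx ht
  · intro hs
    exact ⟨x / s, div_pos hx hs, div_div_cancel₀ hx.ne'⟩

lemma hasDerivWithinAt_const_div {x : ℝ} (t : ℝ) (ht : t ∈ Ioi (0:ℝ)) :
    HasDerivWithinAt (fun t => x / t) (-x / t ^ 2) (Ioi 0) t := by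
  have := (hasDerivAt_const t x).div (hasDerivAt_id t) (ne_of_gt ht)
  simpa using! this.hasDerivWithinAt

lemma injOn_const_div {x : ℝ} (hx : 0 < x) : InjOn (fun t => x / t) (Ioi (0:ℝ)) := by
  intro s _ t _ h
  have : x / (x / s) = x / (x / t) := by rw [show x / s = x / t from h]
  rwa [div_div_cancel₀ hx.ne', div_div_cancel₀ hx.ne'] at this

lemma airyMoment_integrand_const_div {x : ℝ} (hx : 0 < x) (b : ℝ) {t : ℝ} (ht : 0 < t) :
    |-x / t ^ 2| • ((x / t) ^ b * airyKernel x (x / t)) =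
      x ^ (b + 1) * (t ^ (-2 - b) * airyKernel x t) := by
  rw [airyKernel_div hx ht, div_rpow hx.le ht.le, smul_eq_mul, neg_div, abs_neg,
    abs_of_pos (by positivity), rpow_add_one hx.ne', sub_eq_add_neg, rpow_add ht,
    rpow_neg ht.le, rpow_neg ht.le]
  rw [show t ^ (2:ℝ) = t ^ 2 by exact_mod_cast rpow_natCast t 2]
  field_simp

lemma airyMoment_symm {x : ℝ} (hx : 0 < x) (b : ℝ) :
    airyMoment b x = x ^ (b + 1) * airyMoment (-2 - b) x := by
  have h := integral_image_eq_integral_abs_deriv_smul measurableSet_Ioi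
    hasDerivWithinAt_const_div (injOn_const_div hx) (fun t => t ^ b * airyKernel x t)
  rw [image_div_Ioi hx] at h
  unfold airyMoment
  rw [h, ← integral_const_mul]
  exact setIntegral_congr_fun measurableSet_Ioi fun t ht => airyMoment_integrand_const_div hx b ht

lemma integrableOn_airyKernel_of_lt_neg_one {b x : ℝ} (hb : b < -1) (hx : 0 < x) :
    IntegrableOn (fun t => t ^ b * airyKernel x t) (Ioi 0) := by
  rw [← image_div_Ioi hx, integrableOn_image_iff_integrableOn_abs_deriv_smul measurableSet_Ioi
    hasDerivWithinAt_const_div (injOn_const_div hx)]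
  refine IntegrableOn.congr_fun (f := fun t => x ^ (b + 1) * (t ^ (-2 - b) * airyKernel x t)) ?_
    (fun t ht => (airyMoment_integrand_const_div hx b ht).symm) measurableSet_Ioi
  exact (integrableOn_airyKernel_of_neg_one_lt (by linarith) hx.le).const_mul _

lemma hasDerivAt_airyKernel (x : ℝ) {t : ℝ} (ht : 0 < t) :
    HasDerivAt (fun x => airyKernel x t) (-(x ^ 2 / t ^ 3) * airyKernel x t) x := by
  unfold airyKernel
  have h1 : HasDerivAt (fun x => (x / t) ^ 3) (3 * (x / t) ^ 2 * (1 / t)) x := by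
    simpa using! ((hasDerivAt_id x).div_const t).pow 3
  have h2 : HasDerivAt (fun x => -(t ^ 3 + (x / t) ^ 3) / 3) (-(3 * (x / t) ^ 2 * (1 / t)) / 3) x :=
    (h1.const_add (t ^ 3)).neg.div_const 3
  have h := h2.exp
  rwa [mul_comm, show -(3 * (x / t) ^ 2 * (1 / t)) / 3 = -(x ^ 2 / t ^ 3) by field_simp] at h

lemma hasDerivAt_airyMoment {a x : ℝ} (ha : -1 < a) (ha2 : a < 2) (hx : 0 < x) :
    HasDerivAt (airyMoment a) (-x ^ a * airyMoment (1 - a) x) x := by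
  have hrew : -x ^ a * airyMoment (1 - a) x =
      ∫ t in Ioi (0:ℝ), t ^ a * (-(x ^ 2 / t ^ 3) * airyKernel x t) := by
    have h := airyMoment_symm hx (a - 3)
    rw [show -2 - (a - 3) = 1 - a by ring, show a - 3 + 1 = a - 2 by ring, rpow_sub hx] at h
    have h2 : ∫ t in Ioi (0:ℝ), t ^ a * (-(x ^ 2 / t ^ 3) * airyKernel x t) =
        -x ^ 2 * airyMoment (a - 3) x := by
      unfold airyMoment
      rw [← integral_const_mul]
      refine setIntegral_congr_fun measurableSet_Ioi fun t (ht : 0 < t) => ?_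
      rw [rpow_sub ht, show t ^ (3:ℝ) = t ^ 3 by exact_mod_cast rpow_natCast t 3]
      ring
    rw [h2, h, show x ^ (2:ℝ) = x ^ 2 by exact_mod_cast rpow_natCast x 2]
    field_simp
  rw [hrew]
  refine (hasDerivAt_integral_of_dominated_loc_of_deriv_le (s := Ioo (x / 2) (2 * x))
    (F' := fun y t => t ^ a * (-(y ^ 2 / t ^ 3) * airyKernel y t))
    (bound := fun t => (2 * x) ^ 2 * (t ^ (a - 3) * airyKernel (x / 2) t))
    (Ioo_mem_nhds (by linarith) (by linarith))
    (.of_forall fun y => (measurable_rpow_mul_airyKernel a y).aestronglyMeasurable)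
    (integrableOn_airyKernel_of_neg_one_lt ha hx.le) ?_ ?_ ?_ ?_).2
  · exact Measurable.aestronglyMeasurable (by unfold airyKernel; fun_prop)
  · refine (ae_restrict_iff' measurableSet_Ioi).2 (.of_forall fun t (ht : 0 < t) y hy => ?_)
    have hy0 : 0 < y := by linarith [hy.1]
    have hk := airyKernel_pos y t
    have hk' := airyKernel_anti (x := x / 2) (y := y) (by linarith) hy.1.le ht
    rw [norm_eq_abs, show t ^ a * (-(y ^ 2 / t ^ 3) * airyKernel y t)
      = -(y ^ 2 * (t ^ a / t ^ 3 * airyKernel y t)) by ring, abs_neg, abs_of_pos (by positivity),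
      rpow_sub ht, show t ^ (3:ℝ) = t ^ 3 by exact_mod_cast rpow_natCast t 3]
    have := hy.2.le
    gcongr
  · exact (integrableOn_airyKernel_of_lt_neg_one (by linarith) (by linarith)).const_mul _
  · refine (ae_restrict_iff' measurableSet_Ioi).2 (.of_forall fun t (ht : 0 < t) y _ => ?_)
    exact (hasDerivAt_airyKernel y ht).const_mul _

lemma continuousOn_airyMoment {a : ℝ} (ha : -1 < a) : ContinuousOn (airyMoment a) (Ici 0) := by
  refine continuousOn_of_dominated (bound := fun t => t ^ a * airyKernel 0 t)
    (fun y _ => (measurable_rpow_mul_airyKernel a y).aestronglyMeasurable) ?_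
    (integrableOn_airyKernel_of_neg_one_lt ha le_rfl) ?_
  · intro y hy
    refine (ae_restrict_iff' measurableSet_Ioi).2 (.of_forall fun t (ht : 0 < t) => ?_)
    have hk := airyKernel_pos y t
    rw [norm_of_nonneg (by positivity)]
    gcongr
    exact airyKernel_anti le_rfl hy ht
  · refine (ae_restrict_iff' measurableSet_Ioi).2 (.of_forall fun t (ht : 0 < t) => ?_)
    exact Continuous.continuousOn (by unfold airyKernel; fun_prop)

lemma airyMoment_zero_right {a : ℝ} (ha : -1 < a) :
    airyMoment a 0 = 3 ^ ((a + 1) / 3) * (1 / 3) * Gamma ((a + 1) / 3) := by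
  have h := integral_rpow_mul_exp_neg_mul_rpow (p := 3) (q := a) (b := 1/3)
    (by norm_num) ha (by norm_num)
  unfold airyMoment
  simp_rw [airyKernel_zero_left]
  rw [h, neg_div, one_div, inv_rpow (by norm_num), ← rpow_neg (by norm_num), neg_neg]

lemma airyMoment_pos {a x : ℝ} (ha : -1 < a) (hx : 0 ≤ x) : 0 < airyMoment a x := by
  unfold airyMoment
  refine (setIntegral_pos_iff_support_of_nonneg_ae ?_
    (integrableOn_airyKernel_of_neg_one_lt ha hx)).2 ?_
  · refine (ae_restrict_iff' measurableSet_Ioi).2 (.of_forall fun t (ht : 0 < t) => ?_)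
    have hk := airyKernel_pos x t
    simp only [Pi.zero_apply]
    positivity
  · refine lt_of_lt_of_le (b := volume (Ioi (0:ℝ))) (by simp) (measure_mono fun t ht => ⟨?_, ht⟩)
    exact (mul_pos (rpow_pos_of_pos ht a) (airyKernel_pos x t)).ne'

lemma airyMoment_le_zero_right {a x : ℝ} (ha : -1 < a) (hx : 0 ≤ x) :
    airyMoment a x ≤ airyMoment a 0 := by
  refine setIntegral_mono_on (integrableOn_airyKernel_of_neg_one_lt ha hx)
    (integrableOn_airyKernel_of_neg_one_lt ha le_rfl) measurableSet_Ioi fun t (ht : 0 < t) => ?_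
  have := airyKernel_anti le_rfl hx ht
  gcongr

lemma airyMoment_half_sq_le {x : ℝ} (hx : 0 ≤ x) :
    airyMoment (1/2) x ^ 2 ≤ airyMoment 0 x * airyMoment 1 x := by
  have hI := airyMoment_pos (a := 0) (by norm_num) hx
  have hJ := airyMoment_pos (a := 1) (by norm_num) hx
  have hH := airyMoment_pos (a := 1/2) (by norm_num) hx
  have key : ∀ l : ℝ, 2 * l * airyMoment (1/2) x ≤ l ^ 2 * airyMoment 0 x + airyMoment 1 x := by
    intro l
    have i0 := integrableOn_airyKernel_of_neg_one_lt (a := 0) (by norm_num) hx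
    have i1 := integrableOn_airyKernel_of_neg_one_lt (a := 1) (by norm_num) hx
    have ih := integrableOn_airyKernel_of_neg_one_lt (a := 1/2) (by norm_num) hx
    unfold airyMoment
    rw [← integral_const_mul, ← integral_const_mul, ← integral_add (i0.const_mul _) i1]
    refine setIntegral_mono_on (ih.const_mul _) ((i0.const_mul _).add i1) measurableSet_Ioi
      fun t (ht : 0 < t) => ?_
    have hk := airyKernel_pos x t
    rw [← sqrt_eq_rpow, rpow_zero, rpow_one]
    have := sq_sqrt ht.le
    nlinarith [mul_nonneg (sq_nonneg (l - √t)) hk.le]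
  have := key (airyMoment (1/2) x / airyMoment 0 x)
  field_simp at this
  nlinarith

lemma airyMoment_zero_le_half {x : ℝ} (hx : 0 < x) :
    airyMoment 0 x ≤ x ^ (-(1:ℝ)/4) * airyMoment (1/2) x := by
  have i0 := integrableOn_airyKernel_of_neg_one_lt (a := 0) (by norm_num) hx.le
  have ih := integrableOn_airyKernel_of_neg_one_lt (a := 1/2) (by norm_num) hx.le
  have im := integrableOn_airyKernel_of_lt_neg_one (b := -5/2) (by norm_num) hx
  have hs := airyMoment_symm hx (-5/2)
  have key : 6 * airyMoment 0 x ≤ 5 * x ^ (-(1:ℝ)/4) * airyMoment (1/2) x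
      + x ^ ((5:ℝ)/4) * airyMoment (-5/2) x := by
    unfold airyMoment
    rw [← integral_const_mul, ← integral_const_mul, ← integral_const_mul,
      ← integral_add (ih.const_mul _) (im.const_mul _)]
    refine setIntegral_mono_on (i0.const_mul _) ((ih.const_mul _).add (im.const_mul _))
      measurableSet_Ioi fun t (ht : 0 < t) => ?_
    have hk := airyKernel_pos x t
    set r := x ^ (-(1:ℝ)/4) * t ^ ((1:ℝ)/2) with hr
    have hr0 : 0 < r := by positivity
    have h5 : x ^ ((5:ℝ)/4) * t ^ (-(5:ℝ)/2) = (r ^ 5)⁻¹ := by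
      rw [hr, mul_pow, ← rpow_natCast, ← rpow_natCast, ← rpow_mul hx.le, ← rpow_mul ht.le, mul_inv,
        ← rpow_neg hx.le, ← rpow_neg ht.le]
      norm_num
    have hpoly : 6 ≤ 5 * r + (r ^ 5)⁻¹ := by
      rw [← sub_nonneg, show 5 * r + (r ^ 5)⁻¹ - 6
        = (r - 1) ^ 2 * (5 * r ^ 4 + 4 * r ^ 3 + 3 * r ^ 2 + 2 * r + 1) / r ^ 5 by field_simp; ring]
      positivity
    rw [rpow_zero]
    calc 6 * (1 * airyKernel x t) = 6 * airyKernel x t := by ring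
      _ ≤ (5 * r + (r ^ 5)⁻¹) * airyKernel x t := by gcongr
      _ = _ := by rw [← h5, hr]; ring
  rw [hs, ← mul_assoc, ← rpow_add hx] at key
  norm_num at key ⊢
  linarith

lemma airyMoment_half_zero_sq : airyMoment (1/2) 0 ^ 2 = π / 3 := by
  rw [airyMoment_zero_right (by norm_num)]
  norm_num
  rw [Gamma_one_half_eq, mul_pow, mul_pow, sq_sqrt pi_pos.le, ← sqrt_eq_rpow, sq_sqrt (by norm_num)]
  ring

lemma hasDerivAt_two_thirds_sqrt_pow_three {x : ℝ} (hx : 0 < x) :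
    HasDerivAt (fun x => (2/3) * √x ^ 3) (√x) x := by
  have hs := sqrt_pos.2 hx
  have h := ((hasDerivAt_sqrt hx.ne').fun_pow 3).const_mul (2/3)
  refine h.congr_deriv ?_
  field_simp
  norm_num

lemma eq_apply_zero_of_hasDerivAt_zero {f : ℝ → ℝ} (hc : ContinuousOn f (Ici 0))
    (hd : ∀ y, 0 < y → HasDerivAt f 0 y) {x : ℝ} (hx : 0 ≤ x) : f x = f 0 := by
  rcases hx.eq_or_lt with rfl | hx
  · rfl
  obtain ⟨c, -, he⟩ := exists_hasDerivAt_eq_slope f (fun _ => 0) hx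
    (hc.mono Icc_subset_Ici_self) fun y hy => hd y hy.1
  have h0 := (div_eq_zero_iff.1 he.symm).resolve_right (by linarith)
  linarith

lemma airyMoment_half_eq {x : ℝ} (hx : 0 ≤ x) :
    airyMoment (1/2) x = airyMoment (1/2) 0 * exp (-(2/3) * √x ^ 3) := by
  have hd : ∀ y, 0 < y → HasDerivAt (fun y => airyMoment (1/2) y * exp ((2/3) * √y ^ 3)) 0 y := by
    intro y hy
    have h1 := hasDerivAt_airyMoment (a := 1/2) (by norm_num) (by norm_num) hy
    have hs := sqrt_pos.2 hy
    rw [← sqrt_eq_rpow] at h1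
    norm_num at h1
    have h2 := h1.fun_mul (hasDerivAt_two_thirds_sqrt_pow_three hy).exp
    rwa [show -(√y * airyMoment (1 / 2) y) * exp ((2/3) * √y ^ 3) +
      airyMoment (1 / 2) y * (exp ((2/3) * √y ^ 3) * √y) = 0 by ring] at h2
  have hc : ContinuousOn (fun y => airyMoment (1/2) y * exp ((2/3) * √y ^ 3)) (Ici 0) :=
    (continuousOn_airyMoment (by norm_num)).mul (by fun_prop)
  have : airyMoment (1/2) x * exp ((2/3) * √x ^ 3) = airyMoment (1/2) 0 := by
    simpa using eq_apply_zero_of_hasDerivAt_zero hc hd hx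
  rw [← this, mul_assoc, ← exp_add]
  simp

lemma sqrt_mul_airyMoment_zero_sq_le {x : ℝ} (hx : 0 < x) :
    √x * airyMoment 0 x ^ 2 ≤ airyMoment (1/2) x ^ 2 := by
  have h := airyMoment_zero_le_half hx
  have h0 := airyMoment_pos (a := 0) (by norm_num) hx.le
  have h2 := pow_le_pow_left₀ h0.le h 2
  have hs := sqrt_pos.2 hx
  have e : (x ^ (-(1:ℝ) / 4)) ^ 2 = (√x)⁻¹ := by
    rw [← rpow_natCast, ← rpow_mul hx.le, sqrt_eq_rpow, ← rpow_neg hx.le]; norm_num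
  rw [mul_pow, e] at h2
  calc √x * airyMoment 0 x ^ 2 ≤ √x * ((√x)⁻¹ * airyMoment (1/2) x ^ 2) := by gcongr
    _ = _ := by field_simp

lemma hasDerivAt_airyMoment_zero {x : ℝ} (hx : 0 < x) :
    HasDerivAt (airyMoment 0) (-airyMoment 1 x) x := by
  simpa using hasDerivAt_airyMoment (a := 0) (by norm_num) (by norm_num) hx

lemma hasDerivAt_airyMoment_one {x : ℝ} (hx : 0 < x) :
    HasDerivAt (airyMoment 1) (-(x * airyMoment 0 x)) x := by
  simpa using hasDerivAt_airyMoment (a := 1) (by norm_num) (by norm_num) hx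

lemma airyMoment_one_le {x : ℝ} (hx : 1 ≤ x) :
    airyMoment 1 x ≤ (√x + 1) * airyMoment 0 x := by
  set f : ℝ → ℝ := fun y => (airyMoment 1 y - (√y + 1) * airyMoment 0 y) *
    exp (-((2/3) * √y ^ 3 + y)) with hf
  have hd : ∀ y, 0 < y → HasDerivAt f (airyMoment 0 y * (2 * √y + 1 - 1 / (2 * √y)) *
      exp (-((2/3) * √y ^ 3 + y))) y := by
    intro y hy
    have hs := sqrt_pos.2 hy
    have h1 := (hasDerivAt_airyMoment_one hy).fun_sub
      (((hasDerivAt_sqrt hy.ne').add_const 1).fun_mul (hasDerivAt_airyMoment_zero hy))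
    have h2 := ((hasDerivAt_two_thirds_sqrt_pow_three hy).fun_add (hasDerivAt_id y)).fun_neg.exp
    refine (h1.fun_mul h2).congr_deriv ?_
    have hq := sq_sqrt hy.le
    simp only [id]
    rw [← sub_eq_zero]
    ring_nf
    rw [hq]
    ring
  have hmono : MonotoneOn f (Ici 1) := by
    refine monotoneOn_of_hasDerivWithinAt_nonneg (convex_Ici 1)
      (fun y hy => (hd y (by linarith [show (1:ℝ) ≤ y from hy])).continuousAt.continuousWithinAt)
      (fun y hy => (hd y ?_).hasDerivWithinAt) ?_
    · rw [interior_Ici] at hy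
      linarith [show (1:ℝ) < y from hy]
    · intro y hy
      rw [interior_Ici] at hy
      have hy : 1 < y := hy
      have h0 := airyMoment_pos (a := 0) (x := y) (by norm_num) (by linarith)
      have hs : 1 ≤ √y := one_le_sqrt.2 hy.le
      have : 1 / (2 * √y) ≤ 1 := by
        rw [div_le_one (by linarith)]; linarith
      have : 0 ≤ 2 * √y + 1 - 1 / (2 * √y) := by linarith
      positivity
  have hle : f x ≤ 0 := by
    have hlim : Tendsto (fun y => airyMoment 1 0 * exp (-y)) atTop (𝓝 0) := by
      simpa using (tendsto_exp_neg_atTop_nhds_zero).const_mul (airyMoment 1 0)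
    refine ge_of_tendsto hlim ?_
    filter_upwards [eventually_ge_atTop x] with y hy
    refine (hmono hx (hx.trans hy) hy).trans ?_
    have hy0 : 0 ≤ y := by linarith
    have h0 := airyMoment_pos (a := 0) (by norm_num) hy0
    have h1 := airyMoment_pos (a := 1) (by norm_num) hy0
    have h2 := airyMoment_le_zero_right (a := 1) (by norm_num) hy0
    have hs := sqrt_nonneg y
    calc f y ≤ airyMoment 1 y * exp (-((2/3) * √y ^ 3 + y)) := by
          refine mul_le_mul_of_nonneg_right ?_ (exp_pos _).le
          nlinarith
      _ ≤ airyMoment 1 0 * exp (-y) := by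
          have h3 := h1.le.trans h2
          gcongr
          linarith [pow_nonneg hs 3]
  have := nonpos_of_mul_nonpos_left hle (exp_pos _)
  linarith

lemma airyAlpha_eq : airyAlpha = airyMoment 0 0 / airyMoment 1 0 := by
  rw [airyMoment_zero_right (by norm_num), airyMoment_zero_right (by norm_num), airyAlpha]
  have h : (3:ℝ) ^ ((2:ℝ)/3) = 3 ^ ((1:ℝ)/3) * 3 ^ ((1:ℝ)/3) := by
    rw [← rpow_add (by norm_num)]; norm_num
  have := Gamma_pos_of_pos (s := 2/3) (by norm_num)
  norm_num
  rw [h]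
  field_simp

lemma airyAlpha_pos : 0 < airyAlpha := by
  have := Gamma_pos_of_pos (s := 2/3) (by norm_num)
  have := Gamma_pos_of_pos (s := 1/3) (by norm_num)
  unfold airyAlpha
  positivity

lemma sqrt_three_mul_airyAlpha :
    √3 * airyAlpha = 2 * airyMoment (1/2) 0 ^ 2 / airyMoment 1 0 ^ 2 := by
  rw [airyMoment_half_zero_sq, airyMoment_zero_right (by norm_num), airyAlpha]
  have hr := Gamma_mul_Gamma_one_sub (1/3)
  rw [show π * (1/3) = π / 3 by ring, sin_pi_div_three] at hr
  norm_num at hr ⊢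
  have h : (3:ℝ) ^ ((2:ℝ)/3) = 3 ^ ((1:ℝ)/3) * 3 ^ ((1:ℝ)/3) := by
    rw [← rpow_add (by norm_num)]; norm_num
  have h3 : (3:ℝ) ^ ((1:ℝ)/3) * 3 ^ ((1:ℝ)/3) * 3 ^ ((1:ℝ)/3) = 3 := by
    rw [← rpow_add (by norm_num), ← rpow_add (by norm_num)]; norm_num
  have := Gamma_pos_of_pos (s := 2/3) (by norm_num)
  have := Gamma_pos_of_pos (s := 1/3) (by norm_num)
  have hs : √3 ^ 2 = (3:ℝ) := sq_sqrt (by norm_num)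
  rw [h]
  set t := (3:ℝ) ^ ((1:ℝ)/3)
  have ht : 0 < t := by positivity
  field_simp at hr ⊢
  linear_combination t ^ 3 * hr + 2 * π * h3

/-! ### Canonical solutions on the positive half-line -/

/-- `u`, `v` are the canonical solutions of the Airy equation, with derivatives `u'`, `v'`. -/
structure IsAiryPair (u v u' v' : ℝ → ℝ) : Prop where
  hasDerivAt_u : ∀ x, HasDerivAt u (u' x) x
  hasDerivAt_u' : ∀ x, HasDerivAt u' (x * u x) x
  hasDerivAt_v : ∀ x, HasDerivAt v (v' x) x
  hasDerivAt_v' : ∀ x, HasDerivAt v' (x * v x) x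
  u_zero : u 0 = 1
  u'_zero : u' 0 = 0
  v_zero : v 0 = 0
  v'_zero : v' 0 = 1

namespace IsAiryPair

variable {u v u' v' : ℝ → ℝ}

lemma wronskian (h : IsAiryPair u v u' v') (x : ℝ) : u x * v' x - u' x * v x = 1 := by
  have hd : ∀ x, HasDerivAt (fun x => u x * v' x - u' x * v x) 0 x := by
    intro x
    refine (((h.hasDerivAt_u x).fun_mul (h.hasDerivAt_v' x)).fun_sub
      ((h.hasDerivAt_u' x).fun_mul (h.hasDerivAt_v x))).congr_deriv ?_
    ring
  have := is_const_of_deriv_eq_zero (fun x => (hd x).differentiableAt) (fun x => (hd x).deriv) x 0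
  simpa [h.u_zero, h.u'_zero, h.v_zero, h.v'_zero] using this

lemma continuous_u (h : IsAiryPair u v u' v') : Continuous u :=
  continuous_iff_continuousAt.2 fun x => (h.hasDerivAt_u x).continuousAt

lemma continuous_u' (h : IsAiryPair u v u' v') : Continuous u' :=
  continuous_iff_continuousAt.2 fun x => (h.hasDerivAt_u' x).continuousAt

lemma continuous_v (h : IsAiryPair u v u' v') : Continuous v :=
  continuous_iff_continuousAt.2 fun x => (h.hasDerivAt_v x).continuousAt

lemma continuous_v' (h : IsAiryPair u v u' v') : Continuous v' :=
  continuous_iff_continuousAt.2 fun x => (h.hasDerivAt_v' x).continuousAt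

lemma airyMoment_mul_u (h : IsAiryPair u v u' v') {x : ℝ} (hx : 0 ≤ x) :
    airyMoment 0 x * u' x + airyMoment 1 x * u x = airyMoment 1 0 := by
  have := eq_apply_zero_of_hasDerivAt_zero
    (f := fun x => airyMoment 0 x * u' x + airyMoment 1 x * u x)
    (((continuousOn_airyMoment (by norm_num)).mul h.continuous_u'.continuousOn).add
      ((continuousOn_airyMoment (by norm_num)).mul h.continuous_u.continuousOn))
    (fun y hy => by
      refine (((hasDerivAt_airyMoment_zero hy).fun_mul (h.hasDerivAt_u' y)).fun_add
        ((hasDerivAt_airyMoment_one hy).fun_mul (h.hasDerivAt_u y))).congr_deriv ?_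
      ring) hx
  simpa [h.u_zero, h.u'_zero] using this

lemma airyMoment_mul_v (h : IsAiryPair u v u' v') {x : ℝ} (hx : 0 ≤ x) :
    airyMoment 0 x * v' x + airyMoment 1 x * v x = airyMoment 0 0 := by
  have := eq_apply_zero_of_hasDerivAt_zero
    (f := fun x => airyMoment 0 x * v' x + airyMoment 1 x * v x)
    (((continuousOn_airyMoment (by norm_num)).mul h.continuous_v'.continuousOn).add
      ((continuousOn_airyMoment (by norm_num)).mul h.continuous_v.continuousOn))
    (fun y hy => by
      refine (((hasDerivAt_airyMoment_zero hy).fun_mul (h.hasDerivAt_v' y)).fun_add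
        ((hasDerivAt_airyMoment_one hy).fun_mul (h.hasDerivAt_v y))).congr_deriv ?_
      ring) hx
  simpa [h.v_zero, h.v'_zero] using this

lemma airyMoment_zero_eq (h : IsAiryPair u v u' v') {x : ℝ} (hx : 0 ≤ x) :
    airyMoment 0 x = airyMoment 0 0 * u x - airyMoment 1 0 * v x := by
  linear_combination (-airyMoment 0 x) * h.wronskian x + u x * h.airyMoment_mul_v hx
    - v x * h.airyMoment_mul_u hx

lemma u_mul_u'_nonneg (h : IsAiryPair u v u' v') {x : ℝ} (hx : 0 ≤ x) : 0 ≤ u x * u' x := by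
  have hm : MonotoneOn (fun x => u x * u' x) (Ici 0) := by
    refine monotoneOn_of_hasDerivWithinAt_nonneg (convex_Ici 0)
      (h.continuous_u.mul h.continuous_u').continuousOn
      (fun y _ => ((h.hasDerivAt_u y).fun_mul (h.hasDerivAt_u' y)).hasDerivWithinAt) ?_
    intro y hy
    rw [interior_Ici] at hy
    have hy : 0 < y := hy
    nlinarith [mul_nonneg hy.le (sq_nonneg (u y)), sq_nonneg (u' y)]
  simpa [h.u'_zero] using hm self_mem_Ici hx hx

lemma one_le_u (h : IsAiryPair u v u' v') {x : ℝ} (hx : 0 ≤ x) : 1 ≤ u x := by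
  have hm : MonotoneOn (fun x => u x * u x) (Ici 0) := by
    refine monotoneOn_of_hasDerivWithinAt_nonneg (convex_Ici 0)
      (h.continuous_u.mul h.continuous_u).continuousOn
      (fun y _ => ((h.hasDerivAt_u y).fun_mul (h.hasDerivAt_u y)).hasDerivWithinAt) ?_
    intro y hy
    rw [interior_Ici] at hy
    nlinarith [h.u_mul_u'_nonneg (show (0:ℝ) ≤ y from hy.le)]
  have hsq : ∀ y, 0 ≤ y → 1 ≤ u y * u y := fun y hy => by
    simpa [h.u_zero] using hm self_mem_Ici hy hy
  by_contra! hlt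
  have hneg : u x ≤ 0 := by nlinarith [hsq x hx]
  obtain ⟨y, hy, hy0⟩ := intermediate_value_Icc' hx h.continuous_u.continuousOn
    (show (0:ℝ) ∈ Icc (u x) (u 0) from ⟨hneg, by simp [h.u_zero]⟩)
  have := hsq y hy.1
  rw [hy0] at this
  norm_num at this

lemma u'_nonneg (h : IsAiryPair u v u' v') {x : ℝ} (hx : 0 ≤ x) : 0 ≤ u' x :=
  nonneg_of_mul_nonneg_right (h.u_mul_u'_nonneg hx) (by linarith [h.one_le_u hx])

lemma hasDerivAt_v_div_u (h : IsAiryPair u v u' v') {x : ℝ} (hx : 0 ≤ x) :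
    HasDerivAt (fun x => v x / u x) (1 / u x ^ 2) x := by
  refine ((h.hasDerivAt_v x).fun_div (h.hasDerivAt_u x) ?_).congr_deriv ?_
  · linarith [h.one_le_u hx]
  · rw [← h.wronskian x]; ring

lemma v_pos (h : IsAiryPair u v u' v') {x : ℝ} (hx : 0 < x) : 0 < v x := by
  have hm : StrictMonoOn (fun x => v x / u x) (Ici 0) := by
    refine strictMonoOn_of_hasDerivWithinAt_pos (convex_Ici 0)
      (fun y hy => (h.hasDerivAt_v_div_u hy).continuousAt.continuousWithinAt)
      (fun y hy => (h.hasDerivAt_v_div_u (interior_subset hy)).hasDerivWithinAt) fun y hy => ?_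
    have := h.one_le_u (show 0 ≤ y from interior_subset hy)
    positivity
  have := hm self_mem_Ici hx.le hx
  simp only [h.v_zero, zero_div] at this
  exact (div_pos_iff_of_pos_right (by linarith [h.one_le_u hx.le])).1 this

lemma v_lt (h : IsAiryPair u v u' v') {x : ℝ} (hx : 0 ≤ x) : v x < airyAlpha * u x := by
  have h0 := airyMoment_pos (a := 0) (by norm_num) hx
  have h1 := airyMoment_pos (a := 1) (by norm_num) (le_refl (0:ℝ))
  rw [h.airyMoment_zero_eq hx] at h0
  rw [airyAlpha_eq, div_mul_eq_mul_div, lt_div_iff₀ h1]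
  linarith

lemma u'_le (h : IsAiryPair u v u' v') {x : ℝ} (hx : 0 ≤ x) : u' x ≤ √x * u x := by
  have hm : AntitoneOn (fun x => u' x ^ 2 - x * u x ^ 2) (Ici 0) := by
    refine antitoneOn_of_hasDerivWithinAt_nonpos (f' := fun y => -u y ^ 2) (convex_Ici 0)
      ((h.continuous_u'.pow 2).sub (continuous_id.mul (h.continuous_u.pow 2))).continuousOn
      (fun y _ => HasDerivAt.hasDerivWithinAt ?_) fun y _ => ?_
    · refine (((h.hasDerivAt_u' y).fun_pow 2).fun_sub
        ((hasDerivAt_id y).fun_mul ((h.hasDerivAt_u y).fun_pow 2))).congr_deriv ?_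
      simp
      ring
    · nlinarith [sq_nonneg (u y)]
  have := hm self_mem_Ici hx hx
  simp only [h.u'_zero] at this
  have hu := h.one_le_u hx
  refine abs_le_of_sq_le_sq' ?_ (by positivity) |>.2
  rw [mul_pow, sq_sqrt hx]
  linarith

lemma le_u' (h : IsAiryPair u v u' v') {x : ℝ} (hx : 0 ≤ x) : (√x - 1) * u x ≤ u' x := by
  rcases le_total x 1 with hx1 | hx1
  · have hs : √x ≤ 1 := sqrt_le_one.2 hx1
    nlinarith [h.one_le_u hx, h.u'_nonneg hx]
  have hm : MonotoneOn (fun y => (u' y - (√y - 1) * u y) * exp ((2/3) * √y ^ 3 - y)) (Ici 1) := by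
    refine monotoneOn_of_hasDerivWithinAt_nonneg
      (f' := fun y => u y * (2 * √y - 1 - 1 / (2 * √y)) * exp ((2/3) * √y ^ 3 - y)) (convex_Ici 1)
      (Continuous.continuousOn ?_) (fun y hy => HasDerivAt.hasDerivWithinAt ?_) fun y hy => ?_
    · have := h.continuous_u
      have := h.continuous_u'
      fun_prop
    · rw [interior_Ici] at hy
      have hy : 0 < y := by linarith [show (1:ℝ) < y from hy]
      have h1 := (h.hasDerivAt_u' y).fun_sub
        (((hasDerivAt_sqrt hy.ne').sub_const 1).fun_mul (h.hasDerivAt_u y))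
      have h2 := ((hasDerivAt_two_thirds_sqrt_pow_three hy).fun_sub (hasDerivAt_id y)).exp
      refine (h1.fun_mul h2).congr_deriv ?_
      have hq := sq_sqrt hy.le
      simp only [id]
      rw [← sub_eq_zero]
      ring_nf
      rw [hq]
      ring
    · rw [interior_Ici] at hy
      have hy : 1 < y := hy
      have := h.one_le_u (x := y) (by linarith)
      have hs : 1 ≤ √y := one_le_sqrt.2 hy.le
      have : 1 / (2 * √y) ≤ 1 := by
        rw [div_le_one (by linarith)]; linarith
      have : 0 ≤ 2 * √y - 1 - 1 / (2 * √y) := by linarith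
      positivity
  have h1 := hm self_mem_Ici hx1 hx1
  have h2 : 0 ≤ (u' 1 - (√1 - 1) * u 1) * exp ((2/3) * √1 ^ 3 - 1) := by
    have := h.u'_nonneg (x := 1) (by norm_num)
    simp only [sqrt_one, sub_self, zero_mul, sub_zero]
    positivity
  have := nonneg_of_mul_nonneg_left (h2.trans h1) (exp_pos _)
  linarith

/-- Exponentially precise convergence of `v/u` to `airyAlpha`. -/
lemma abs_airyAlpha_sub_div_sub_le (h : IsAiryPair u v u' v') {x : ℝ} (hx : 1 ≤ x) :
    |airyAlpha - v x / u x - √3 * airyAlpha * exp (-(4/3) * √x ^ 3)| ≤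
      √3 * airyAlpha * exp (-(4/3) * √x ^ 3) / √x := by
  have hx0 : 0 < x := by linarith
  have hI := airyMoment_pos (a := 0) (by norm_num) hx0.le
  have hJ := airyMoment_pos (a := 1) (by norm_num) hx0.le
  have hJ0 := airyMoment_pos (a := 1) (by norm_num) (le_refl (0:ℝ))
  have hu := h.one_le_u hx0.le
  have hs : 1 ≤ √x := one_le_sqrt.2 hx
  have hq1 : u' x / u x ≤ √x := (div_le_iff₀ (by linarith)).2 (h.u'_le hx0.le)
  have hq2 : √x - 1 ≤ u' x / u x := (le_div_iff₀ (by linarith)).2 (h.le_u' hx0.le)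
  have hp1 := airyMoment_one_le hx
  have hCS := airyMoment_half_sq_le hx0.le
  have hI2 := sqrt_mul_airyMoment_zero_sq_le hx0
  have hd : airyAlpha - v x / u x = (airyMoment 0 x * airyMoment 1 x +
      airyMoment 0 x ^ 2 * (u' x / u x)) / airyMoment 1 0 ^ 2 := by
    rw [airyAlpha_eq]
    field_simp
    linear_combination (-airyMoment 1 0) * h.airyMoment_zero_eq hx0.le
      - airyMoment 0 x * h.airyMoment_mul_u hx0.le
  have hΛ : √3 * airyAlpha * exp (-(4/3) * √x ^ 3) =
      2 * airyMoment (1/2) x ^ 2 / airyMoment 1 0 ^ 2 := by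
    rw [sqrt_three_mul_airyAlpha, airyMoment_half_eq hx0.le, mul_pow, ← exp_nat_mul]
    push_cast
    rw [show 2 * (-(2 / 3) * √x ^ 3) = -(4/3) * √x ^ 3 by ring]
    ring
  rw [hΛ, hd, ← sub_div, abs_div, abs_of_pos (show 0 < airyMoment 1 0 ^ 2 by positivity),
    div_div, mul_comm (airyMoment 1 0 ^ 2), ← div_div]
  gcongr
  set I := airyMoment 0 x
  set J := airyMoment 1 x
  set H := airyMoment (1/2) x
  set q := u' x / u x
  set s := √x
  rw [abs_le, ← neg_div, div_le_iff₀ (by linarith), le_div_iff₀ (by linarith)]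
  have hIJ : 0 < I * J := by positivity
  constructor
  · have h1 : I * J ≤ (s + 1) * I ^ 2 := by nlinarith
    have h2 : I ^ 2 * (s - 1) ≤ I ^ 2 * q := by gcongr
    have h3 : I * J * (s - 1) ≤ (s + 1) * (I ^ 2 * q) := by nlinarith
    have h4 : H ^ 2 * (2 * s) ≤ (s + 1) * (I * J + I ^ 2 * q) := by nlinarith
    have hH := sq_nonneg H
    have h5 : (s + 1) * (2 * H ^ 2 * (s - 1)) ≤ (s + 1) * ((I * J + I ^ 2 * q) * s) := by nlinarith
    have := le_of_mul_le_mul_left h5 (by linarith)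
    linarith
  · have h1 : I * J ≤ (s + 1) * I ^ 2 := by nlinarith
    have h2 : I ^ 2 * q ≤ I ^ 2 * s := by gcongr
    have h3 : (I * J + I ^ 2 * q) * s ≤ (2 * s + 1) * (s * I ^ 2) := by nlinarith
    have h4 : (2 * s + 1) * (s * I ^ 2) ≤ (2 * s + 1) * H ^ 2 := by gcongr
    nlinarith [sq_nonneg H]

end IsAiryPair

/-! ### Zeros of `Ai'` and `v'` on the negative half-line -/

lemma AiD_eq (u' v' : ℝ → ℝ) (x : ℝ) :
    AiD u' v' x = (airyAlpha * u' x - v' x) / ((3:ℝ) ^ ((1:ℝ)/3) * Gamma (1/3)) := by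
  have h : (3:ℝ) ^ ((2:ℝ)/3) = 3 ^ ((1:ℝ)/3) * 3 ^ ((1:ℝ)/3) := by
    rw [← rpow_add (by norm_num)]; norm_num
  have := Gamma_pos_of_pos (s := 2/3) (by norm_num)
  have := Gamma_pos_of_pos (s := 1/3) (by norm_num)
  rw [AiD, airyAlpha, h]
  field_simp

lemma AiD_eq_zero_iff {u' v' : ℝ → ℝ} {x : ℝ} :
    AiD u' v' x = 0 ↔ v' x = airyAlpha * u' x := by
  have := Gamma_pos_of_pos (s := 1/3) (by norm_num)
  have hne : (3:ℝ) ^ ((1:ℝ)/3) * Gamma (1/3) ≠ 0 := by positivity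
  rw [AiD_eq, div_eq_zero_iff, or_iff_left hne, sub_eq_zero, eq_comm]

/-- An Airy pair with the largest zero `-c0` of `v'` and the largest zero `-ta1` of `Ai'`. -/
structure IsAirySetup (u v u' v' : ℝ → ℝ) (ta1 c0 : ℝ) : Prop
    extends IsAiryPair u v u' v' where
  ta1_pos : 0 < ta1
  AiD_ta1 : AiD u' v' (-ta1) = 0
  AiD_ne_zero : ∀ x, -ta1 < x → AiD u' v' x ≠ 0
  c0_pos : 0 < c0
  v'_c0 : v' (-c0) = 0
  v'_ne_zero : ∀ x, -c0 < x → v' x ≠ 0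

namespace IsAirySetup

variable {u v u' v' : ℝ → ℝ} {ta1 c0 : ℝ}

lemma v'_pos (h : IsAirySetup u v u' v' ta1 c0) {x : ℝ} (hx : -c0 < x) (hx0 : x ≤ 0) :
    0 < v' x := by
  by_contra! hle
  obtain ⟨y, hy, hy0⟩ := intermediate_value_Icc hx0 h.continuous_v'.continuousOn
    (show (0:ℝ) ∈ Icc (v' x) (v' 0) from ⟨hle, by simp [h.v'_zero]⟩)
  exact h.v'_ne_zero y (hx.trans_le hy.1) hy0

lemma u'_pos (h : IsAirySetup u v u' v' ta1 c0) {x : ℝ} (hx : -c0 ≤ x) (hx0 : x < 0) :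
    0 < u' x := by
  have hpos : ∀ x, -c0 < x → x < 0 → 0 < u' x := by
    intro x hx hx0
    have hd : ∀ y ∈ Ioc (-c0) 0, HasDerivAt (fun y => u' y / v' y) (y / v' y ^ 2) y := by
      intro y hy
      refine ((h.hasDerivAt_u' y).fun_div (h.hasDerivAt_v' y) (h.v'_pos hy.1 hy.2).ne').congr_deriv ?_
      congr 1
      linear_combination y * h.wronskian y
    have hm : StrictAntiOn (fun y => u' y / v' y) (Ioc (-c0) 0) := by
      refine strictAntiOn_of_hasDerivWithinAt_neg (convex_Ioc _ _)
        (fun y hy => (hd y hy).continuousAt.continuousWithinAt)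
        (fun y hy => (hd y (interior_subset hy)).hasDerivWithinAt) fun y hy => ?_
      rw [interior_Ioc] at hy
      have := h.v'_pos hy.1 hy.2.le
      exact div_neg_of_neg_of_pos hy.2 (by positivity)
    have := hm ⟨hx, hx0.le⟩ ⟨neg_lt_zero.2 h.c0_pos, le_rfl⟩ hx0
    simp only [h.u'_zero, zero_div] at this
    exact (div_pos_iff_of_pos_right (h.v'_pos hx hx0.le)).1 this
  rcases hx.eq_or_lt with rfl | hx
  · have hge : 0 ≤ u' (-c0) := by
      refine ge_of_tendsto (h.continuous_u'.tendsto (-c0) |>.mono_left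
        (nhdsWithin_le_nhds (s := Ioi (-c0)))) ?_
      filter_upwards [Ioo_mem_nhdsGT hx0] with y hy using (hpos y hy.1 hy.2).le
    refine hge.lt_of_ne' fun h0 => ?_
    have := h.wronskian (-c0)
    rw [h0, h.v'_c0] at this
    norm_num at this
  · exact hpos x hx hx0

lemma u'_sq_lt (h : IsAirySetup u v u' v' ta1 c0) {x : ℝ} (hx : -c0 ≤ x) (hx0 : x < 0) :
    u' x ^ 2 < -x := by
  set w : ℝ → ℝ := fun y => u' y ^ 2 - y * u y ^ 2 with hw
  have hwd : ∀ y, HasDerivAt w (-u y ^ 2) y := by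
    intro y
    refine (((h.hasDerivAt_u' y).fun_pow 2).fun_sub
      ((hasDerivAt_id y).fun_mul ((h.hasDerivAt_u y).fun_pow 2))).congr_deriv ?_
    simp
    ring
  have hd : ∀ y ∈ Ico (-c0) 0, HasDerivAt (fun y => w y / y) (-(u' y ^ 2 / y ^ 2)) y := by
    intro y hy
    refine ((hwd y).fun_div (hasDerivAt_id y) hy.2.ne).congr_deriv ?_
    simp only [hw, id]
    have := hy.2.ne
    field_simp
    ring
  have hm : StrictAntiOn (fun y => w y / y) (Ico (-c0) 0) := by
    refine strictAntiOn_of_hasDerivWithinAt_neg (convex_Ico _ _)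
      (fun y hy => (hd y hy).continuousAt.continuousWithinAt)
      (fun y hy => (hd y (interior_subset hy)).hasDerivWithinAt) fun y hy => ?_
    have hy := interior_subset hy
    have h1 := h.u'_pos hy.1 hy.2
    have h2 := hy.2.ne
    have : 0 < u' y ^ 2 / y ^ 2 := by positivity
    linarith
  have hlim : Tendsto (fun y => w y / y) (𝓝[<] 0) (𝓝 (-1)) := by
    have hs := hasDerivAt_iff_tendsto_slope.1 (hwd 0)
    rw [h.u_zero] at hs
    norm_num at hs
    refine (hs.mono_left (nhdsWithin_mono _ fun y hy => ne_of_lt hy)).congr fun y => ?_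
    simp [slope, hw, h.u'_zero, div_eq_inv_mul]
  have hmid : -1 ≤ w (x / 2) / (x / 2) := by
    refine le_of_tendsto hlim ?_
    filter_upwards [Ioo_mem_nhdsLT (show x / 2 < 0 by linarith)] with y hy
    exact (hm ⟨by linarith, by linarith⟩ ⟨by linarith [hy.1], hy.2⟩ hy.1).le
  have := hm ⟨hx, hx0⟩ ⟨by linarith, by linarith⟩ (show x < x / 2 by linarith)
  have h3 : -1 < w x / x := hmid.trans_lt this
  rw [lt_div_iff_of_neg hx0] at h3
  simp only [hw] at h3
  nlinarith [sq_nonneg (u x)]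

lemma hasDerivAt_v'_div_u' (h : IsAirySetup u v u' v' ta1 c0) {x : ℝ} (hx : -c0 ≤ x)
    (hx0 : x < 0) : HasDerivAt (fun x => v' x / u' x) (-x / u' x ^ 2) x := by
  refine ((h.hasDerivAt_v' x).fun_div (h.hasDerivAt_u' x) (h.u'_pos hx hx0).ne').congr_deriv ?_
  congr 1
  linear_combination (-x) * h.wronskian x

lemma ta1_lt_c0 (h : IsAirySetup u v u' v' ta1 c0) : ta1 < c0 := by
  by_contra! hle
  have hc := h.c0_pos
  have h1 := h.u'_pos le_rfl (neg_lt_zero.2 hc)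
  have h2 := airyAlpha_pos
  have hcont : ContinuousOn (fun x => v' x - airyAlpha * u' x) (Icc (-c0) 0) := by
    have := h.continuous_v'
    have := h.continuous_u'
    fun_prop
  obtain ⟨y, hy, hy0⟩ := intermediate_value_Ioo (by linarith : -c0 ≤ 0) hcont
    (show (0:ℝ) ∈ Ioo _ _ from ⟨by simp only [h.v'_c0]; nlinarith,
      by simp only [h.v'_zero, h.u'_zero]; norm_num⟩)
  exact h.AiD_ne_zero y (by linarith [hy.1]) (AiD_eq_zero_iff.2 (by linarith))

lemma v'_ta1_div (h : IsAirySetup u v u' v' ta1 c0) : v' (-ta1) / u' (-ta1) = airyAlpha := by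
  have := h.u'_pos (x := -ta1) (by linarith [h.ta1_lt_c0]) (by linarith [h.ta1_pos])
  rw [div_eq_iff this.ne', AiD_eq_zero_iff.1 h.AiD_ta1]

lemma eq_iff_div_eq (h : IsAirySetup u v u' v' ta1 c0) {x y : ℝ} (hx : -c0 ≤ x) (hx0 : x < 0)
    (hy : 0 ≤ y) : v y * u' x = u y * v' x ↔ v' x / u' x - v y / u y = 0 := by
  have h1 := h.u'_pos hx hx0
  have h2 := h.one_le_u hy
  rw [sub_eq_zero, div_eq_div_iff h1.ne' (by linarith), eq_comm, mul_comm (u y)]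

lemma hasDerivAt_gap (h : IsAirySetup u v u' v' ta1 c0) {c x : ℝ} (hx : -c0 ≤ x) (hx0 : x < 0)
    (hc : c0 ≤ c) : HasDerivAt (fun x => v' x / u' x - v (c + x) / u (c + x))
      (-x / u' x ^ 2 - 1 / u (c + x) ^ 2) x := by
  have h1 := (h.hasDerivAt_v_div_u (x := c + x) (by linarith)).comp_const_add c x
  exact (h.hasDerivAt_v'_div_u' hx hx0).fun_sub h1

lemma one_lt_neg_div_u'_sq (h : IsAirySetup u v u' v' ta1 c0) {x : ℝ} (hx : -c0 ≤ x)
    (hx0 : x < 0) : 1 < -x / u' x ^ 2 := by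
  have h1 := h.u'_pos hx hx0
  rw [one_lt_div (by positivity)]
  exact h.u'_sq_lt hx hx0

lemma strictMonoOn_gap (h : IsAirySetup u v u' v' ta1 c0) {c : ℝ} (hc : c0 ≤ c) :
    StrictMonoOn (fun x => v' x / u' x - v (c + x) / u (c + x)) (Ico (-c0) 0) := by
  refine strictMonoOn_of_hasDerivWithinAt_pos (convex_Ico _ _)
    (fun x hx => (h.hasDerivAt_gap hx.1 hx.2 hc).continuousAt.continuousWithinAt)
    (fun x hx => (h.hasDerivAt_gap (interior_subset hx).1 (interior_subset hx).2
      hc).hasDerivWithinAt) fun x hx => ?_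
  have hx := interior_subset hx
  have h1 := h.one_lt_neg_div_u'_sq hx.1 hx.2
  have h2 := h.one_le_u (x := c + x) (by linarith [hx.1])
  have h3 : 1 / u (c + x) ^ 2 ≤ 1 := by
    rw [div_le_one (by positivity)]
    nlinarith
  linarith

/-- Existence and uniqueness of the solution of the matching equation, in terms of `x = -c - E`. -/
lemma existsUnique_matching (h : IsAirySetup u v u' v' ta1 c0) {c : ℝ} (hc : c0 < c) :
    ∃! x, -c0 ≤ x ∧ x < -ta1 ∧ v (c + x) * u' x = u (c + x) * v' x := by
  have ht := h.ta1_pos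
  have htc := h.ta1_lt_c0
  have hsub : Icc (-c0) (-ta1) ⊆ Ico (-c0) 0 := fun x hx => ⟨hx.1, by linarith [hx.2]⟩
  have hcont : ContinuousOn (fun x => v' x / u' x - v (c + x) / u (c + x)) (Icc (-c0) (-ta1)) :=
    fun x hx => (h.hasDerivAt_gap (hsub hx).1 (hsub hx).2 hc.le).continuousAt.continuousWithinAt
  have hneg : v' (-c0) / u' (-c0) - v (c + -c0) / u (c + -c0) < 0 := by
    have h1 := h.v_pos (x := c + -c0) (by linarith)
    have h2 := h.one_le_u (x := c + -c0) (by linarith)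
    have : 0 < v (c + -c0) / u (c + -c0) := by positivity
    rw [h.v'_c0, zero_div]
    linarith
  have hpos : 0 < v' (-ta1) / u' (-ta1) - v (c + -ta1) / u (c + -ta1) := by
    have h1 := h.v_lt (x := c + -ta1) (by linarith)
    have h2 := h.one_le_u (x := c + -ta1) (by linarith)
    rw [h.v'_ta1_div, sub_pos, div_lt_iff₀ (by linarith)]
    exact h1
  obtain ⟨x, hx, hx0⟩ := intermediate_value_Ioo (by linarith : -c0 ≤ -ta1) hcont
    (show (0:ℝ) ∈ Ioo _ _ from ⟨hneg, hpos⟩)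
  refine ⟨x, ⟨hx.1.le, hx.2, ?_⟩, ?_⟩
  · exact (h.eq_iff_div_eq hx.1.le (by linarith [hx.2]) (by linarith [hx.1])).2 hx0
  · rintro y ⟨hy1, hy2, hy3⟩
    rw [h.eq_iff_div_eq hy1 (by linarith) (by linarith)] at hy3
    exact (h.strictMonoOn_gap hc.le).injOn ⟨hy1, by linarith⟩ ⟨hx.1.le, by linarith [hx.2]⟩
      (hy3.trans hx0.symm)

lemma exists_eq_mul (h : IsAirySetup u v u' v' ta1 c0) {x : ℝ} (hx : -c0 ≤ x) (hxt : x < -ta1) :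
    ∃ y ∈ Ioo x (-ta1), airyAlpha - v' x / u' x = -y / u' y ^ 2 * (-ta1 - x) := by
  have ht := h.ta1_pos
  obtain ⟨y, hy, he⟩ := exists_hasDerivAt_eq_slope (fun x => v' x / u' x)
    (fun x => -x / u' x ^ 2) hxt
    (fun z hz => (h.hasDerivAt_v'_div_u' (hx.trans hz.1)
      (by linarith [hz.2])).continuousAt.continuousWithinAt)
    (fun z hz => h.hasDerivAt_v'_div_u' (hx.trans hz.1.le) (by linarith [hz.2]))
  refine ⟨y, hy, ?_⟩
  rw [he, h.v'_ta1_div, div_mul_cancel₀]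
  linarith

lemma le_airyAlpha_sub (h : IsAirySetup u v u' v' ta1 c0) {x : ℝ} (hx : -c0 ≤ x)
    (hxt : x < -ta1) : -ta1 - x ≤ airyAlpha - v' x / u' x := by
  obtain ⟨y, hy, he⟩ := h.exists_eq_mul hx hxt
  have := h.one_lt_neg_div_u'_sq (hx.trans hy.1.le) (by linarith [hy.2, h.ta1_pos])
  rw [he]
  nlinarith

lemma exists_taylor_bound (h : IsAirySetup u v u' v' ta1 c0) :
    ∃ M, 0 ≤ M ∧ ∀ x, -c0 ≤ x → x < -ta1 →
      |airyAlpha - v' x / u' x - ta1 / u' (-ta1) ^ 2 * (-ta1 - x)| ≤ M * (-ta1 - x) ^ 2 := by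
  have ht := h.ta1_pos
  have htc := h.ta1_lt_c0
  have hu : ∀ x ∈ Icc (-c0) (-ta1), 0 < u' x := fun x hx => h.u'_pos hx.1 (by linarith [hx.2])
  have hd : ∀ x ∈ Icc (-c0) (-ta1), HasDerivAt (fun x => -x / u' x ^ 2)
      ((-1 * u' x ^ 2 - -x * (2 * u' x * (x * u x))) / (u' x ^ 2) ^ 2) x := by
    intro x hx
    have h2 : HasDerivAt (fun x => u' x ^ 2) (2 * u' x * (x * u x)) x := by
      simpa using (h.hasDerivAt_u' x).fun_pow 2
    exact (hasDerivAt_neg x).fun_div h2 (pow_pos (hu x hx) 2).ne'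
  have hcont : ContinuousOn
      (fun x => (-1 * u' x ^ 2 - -x * (2 * u' x * (x * u x))) / (u' x ^ 2) ^ 2)
      (Icc (-c0) (-ta1)) := by
    have := h.continuous_u
    have := h.continuous_u'
    exact ContinuousOn.div (by fun_prop) (by fun_prop) fun x hx => (pow_pos (pow_pos (hu x hx) 2) 2).ne'
  obtain ⟨M, hM⟩ := isCompact_Icc.exists_bound_of_continuousOn hcont
  have hmem : -ta1 ∈ Icc (-c0) (-ta1) := ⟨by linarith, le_rfl⟩
  refine ⟨M, (norm_nonneg _).trans (hM _ hmem), fun x hx hxt => ?_⟩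
  obtain ⟨y, hy, he⟩ := h.exists_eq_mul hx hxt
  have hL := (convex_Icc (-c0) (-ta1)).norm_image_sub_le_of_norm_hasDerivWithin_le
    (fun z hz => (hd z hz).hasDerivWithinAt) hM hmem
    (show y ∈ Icc (-c0) (-ta1) from ⟨by linarith [hy.1], hy.2.le⟩)
  simp only [norm_eq_abs, neg_neg] at hL
  have hM0 : 0 ≤ M := (norm_nonneg _).trans (hM _ hmem)
  rw [he, ← sub_mul, abs_mul, abs_of_pos (show 0 < -ta1 - x by linarith),
    sq (-ta1 - x), ← mul_assoc]
  refine mul_le_mul_of_nonneg_right (hL.trans ?_) (by linarith)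
  rw [abs_of_neg (by linarith [hy.2])]
  gcongr
  linarith [hy.1]

end IsAirySetup

/-! ### Exponential asymptotics -/

lemma abs_exp_sub_one_le_mul_exp_abs (x : ℝ) : |exp x - 1| ≤ |x| * exp |x| := by
  rcases le_total 0 x with hx | hx
  · rw [abs_of_nonneg hx, abs_of_nonneg (by linarith [add_one_le_exp x])]
    have h := mul_le_mul_of_nonneg_right (add_one_le_exp (-x)) (exp_pos x).le
    rw [← exp_add, neg_add_cancel, exp_zero] at h
    linarith
  · have h1 : exp x ≤ 1 := exp_le_one_iff.2 hx
    rw [abs_of_nonpos hx, abs_of_nonpos (by linarith)]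
    have h2 : 1 ≤ exp (-x) := one_le_exp (by linarith)
    nlinarith [add_one_le_exp x]

/-- Second order expansion of `c ↦ c^(3/2)`, with `a = √c` and `b = √(c - ζ)`. -/
lemma abs_exponent_sub_le {a b k : ℝ} (ha : 0 < a) (hb : 0 < b) (hba : b ≤ a)
    (hk : a ^ 2 - b ^ 2 ≤ k) :
    |4/3 * (a ^ 3 - b ^ 3) - 2 * (a ^ 2 - b ^ 2) * a| ≤ 4/3 * k ^ 2 / a := by
  have e : 4/3 * (a ^ 3 - b ^ 3) - 2 * (a ^ 2 - b ^ 2) * a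
      = -(2/3 * ((a - b) ^ 2 * (a + 2 * b))) := by ring
  have h0 : 0 ≤ (a - b) ^ 2 * (a + 2 * b) := by positivity
  rw [e, abs_neg, abs_of_nonneg (by positivity), le_div_iff₀ ha]
  have h1 : (a - b) ^ 2 * (a + 2 * b) * a ≤ 2 * (a ^ 2 - b ^ 2) ^ 2 := by
    have : 2 * (a ^ 2 - b ^ 2) ^ 2 - (a - b) ^ 2 * (a + 2 * b) * a
        = (a - b) ^ 2 * (a ^ 2 + 2 * a * b + 2 * b ^ 2) := by ring
    have : 0 ≤ (a - b) ^ 2 * (a ^ 2 + 2 * a * b + 2 * b ^ 2) := by positivity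
    linarith
  have h2 : (a ^ 2 - b ^ 2) ^ 2 ≤ k ^ 2 := by
    have : 0 ≤ a ^ 2 - b ^ 2 := by nlinarith
    gcongr
  linarith

/-- Transfer of the leading order from the exponential `e` to a comparable one `T`. -/
lemma abs_sub_mul_le_and_mul_le {L P R a b d e T η : ℝ} (hL : 0 < L) (hP0 : 0 ≤ P) (hR0 : 0 ≤ R)
    (ha : 1 ≤ a) (hT0 : 0 < T) (hη : 0 ≤ η) (hηd : η ≤ d) (hinv : 1 / b ≤ P / a)
    (hb0 : 0 < b)
    (hd : |d - L * e| ≤ L * e / b) (hd2 : d ≤ 2 * (L * e)) (hη2 : η ≤ 2 * L * P ^ 2 / a ^ 2)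
    (heT2 : |e - T| ≤ R / a * T) (heT3 : e ≤ (1 + R) * T) :
    |d - L * T| ≤ (L * (P * (1 + R) + R) + 2 * L * P ^ 2 * (2 * L * (1 + R))) / a * T ∧
      η * d ≤ (L * (P * (1 + R) + R) + 2 * L * P ^ 2 * (2 * L * (1 + R))) / a * T := by
  have haa : 1 / a ^ 2 ≤ 1 / a := by
    apply one_div_le_one_div_of_le (by linarith)
    nlinarith
  have ha0 : 0 < a := by linarith
  have hd0 : 0 ≤ d := hη.trans hηd
  have hA0 : 0 ≤ L * (P * (1 + R) + R) := by positivity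
  have hB0 : 0 ≤ 2 * L * P ^ 2 * (2 * L * (1 + R)) := by positivity
  constructor
  · calc |d - L * T| = |(d - L * e) + L * (e - T)| := by ring_nf
      _ ≤ |d - L * e| + |L * (e - T)| := abs_add_le _ _
      _ ≤ L * e * (1 / b) + L * |e - T| := by
          rw [abs_mul, abs_of_pos hL]
          rw [div_eq_mul_one_div] at hd
          gcongr
      _ ≤ L * ((1 + R) * T) * (P / a) + L * (R / a * T) := by gcongr
      _ = L * (P * (1 + R) + R) / a * T := by ring
      _ ≤ _ := by gcongr; exact le_add_of_nonneg_right hB0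
  · have hd3 : d ≤ 2 * (L * ((1 + R) * T)) :=
      hd2.trans (mul_le_mul_of_nonneg_left (mul_le_mul_of_nonneg_left heT3 hL.le) zero_le_two)
    calc η * d ≤ 2 * L * P ^ 2 / a ^ 2 * (2 * (L * ((1 + R) * T))) := by
          exact mul_le_mul hη2 hd3 hd0 (by positivity)
      _ = 2 * L * P ^ 2 * (2 * L * (1 + R)) * T * (1 / a ^ 2) := by ring
      _ ≤ 2 * L * P ^ 2 * (2 * L * (1 + R)) * T * (1 / a) := by 
          exact mul_le_mul_of_nonneg_left haa (mul_nonneg hB0 hT0.le)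
      _ = 2 * L * P ^ 2 * (2 * L * (1 + R)) / a * T := by ring
      _ ≤ _ := by gcongr; exact le_add_of_nonneg_left hA0

/-- Stability of the leading exponential term, with `T` the exponential in the final estimate and
`d` the distance of the logarithmic ratio to its limit. -/
lemma exists_exponential_estimate {L k t : ℝ} (hL : 0 < L) (hk : 0 ≤ k) :
    ∃ K, 0 ≤ K ∧ ∀ a b η d : ℝ, 1 ≤ b → b ≤ a → a ^ 2 - b ^ 2 ≤ k → a ^ 2 - b ^ 2 = t + η →
      0 ≤ η → η ≤ d → |d - L * exp (-(4/3) * b ^ 3)| ≤ L * exp (-(4/3) * b ^ 3) / b →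
      |d - L * exp (-(4/3) * a ^ 3 + 2 * t * a)| ≤ K / a * exp (-(4/3) * a ^ 3 + 2 * t * a) ∧
      η * d ≤ K / a * exp (-(4/3) * a ^ 3 + 2 * t * a) := by
  set P := 1 + k with hP
  set Q := 4 * L * P ^ 2 + 4/3 * k ^ 2 with hQ
  set R := Q * exp Q with hR
  have hP1 : 1 ≤ P := by linarith
  have hQ0 : 0 ≤ Q := by positivity
  have hR0 : 0 ≤ R := by positivity
  refine ⟨L * (P * (1 + R) + R) + 2 * L * P ^ 2 * (2 * L * (1 + R)), by positivity, ?_⟩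
  intro a b η d hb hba hk2 heq hη hηd hd
  have ha : 1 ≤ a := hb.trans hba
  set e := exp (-(4/3) * b ^ 3) with he
  set T := exp (-(4/3) * a ^ 3 + 2 * t * a) with hT
  have he0 : 0 < e := exp_pos _
  have hT0 : 0 < T := exp_pos _
  have hinv : 1 / b ≤ P / a := by
    rw [div_le_div_iff₀ (by linarith) (by linarith), one_mul]
    refine (pow_le_pow_iff_left₀ (by linarith) (by positivity) two_ne_zero).1 ?_
    have hb2 : 1 ≤ b ^ 2 := one_le_pow₀ hb
    rw [hP]
    nlinarith [mul_nonneg hk (sub_nonneg.2 hb2), mul_nonneg hk (sq_nonneg b), sq_nonneg (k * b)]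
  have hinv2 : 1 / b ^ 2 ≤ P ^ 2 / a ^ 2 := by
    rw [← div_pow, show 1 / b ^ 2 = (1 / b) ^ 2 by rw [div_pow, one_pow]]
    gcongr
  have hb1 : L * e / b ≤ L * e := div_le_self (by positivity) hb
  have hd2 : d ≤ 2 * (L * e) := by linarith [(abs_le.1 hd).2]
  have heb : e ≤ 1 / b ^ 2 := by
    have h1 := add_one_le_exp (4/3 * b ^ 3)
    have h2 : b ^ 2 ≤ b ^ 3 := pow_le_pow_right₀ hb (by norm_num)
    have h3 : b ^ 2 ≤ exp (4/3 * b ^ 3) := by nlinarith [sq_nonneg b]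
    rw [he, neg_mul, exp_neg, one_div]
    gcongr
  have hη2 : η ≤ 2 * L * P ^ 2 / a ^ 2 := by
    calc η ≤ 2 * L * e := by linarith
      _ ≤ 2 * L * (P ^ 2 / a ^ 2) := by gcongr; exact heb.trans hinv2
      _ = _ := by ring
  have hηa : η * a ≤ 2 * L * P ^ 2 / a := by
    calc η * a ≤ 2 * L * P ^ 2 / a ^ 2 * a := by gcongr
      _ = _ := by field_simp
  set δ := -(4/3) * b ^ 3 - (-(4/3) * a ^ 3 + 2 * t * a) with hδ
  have heT : e = T * exp δ := by
    rw [he, hT, ← exp_add, hδ]; congr 1; ring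
  have hδ2 : |δ| ≤ Q / a := by
    have h1 := abs_exponent_sub_le (by linarith) (by linarith) hba hk2
    have h2 : δ = 4/3 * (a ^ 3 - b ^ 3) - 2 * (a ^ 2 - b ^ 2) * a + 2 * (η * a) := by
      rw [hδ, heq]; ring
    rw [h2]
    have h3 : 0 ≤ η * a := by positivity
    calc _ ≤ _ := abs_add_le _ _
      _ ≤ 4/3 * k ^ 2 / a + 2 * (2 * L * P ^ 2 / a) := by
          rw [abs_of_nonneg (show 0 ≤ 2 * (η * a) by positivity)]
          gcongr
      _ = Q / a := by rw [hQ]; ring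
  have hQa : Q / a ≤ Q := div_le_self hQ0 ha
  have heT2 : |e - T| ≤ R / a * T := by
    rw [heT, show T * exp δ - T = T * (exp δ - 1) by ring, abs_mul, abs_of_pos hT0, mul_comm]
    gcongr
    calc _ ≤ _ := abs_exp_sub_one_le_mul_exp_abs δ
      _ ≤ Q / a * exp Q := by gcongr; exact hδ2.trans hQa
      _ = R / a := by rw [hR]; ring
  have heT3 : e ≤ (1 + R) * T := by
    have := div_le_self hR0 ha
    nlinarith [(abs_le.1 heT2).2]
  exact abs_sub_mul_le_and_mul_le hL (by linarith) hR0 ha hT0 hη hηd hinv (by linarith) hd hd2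
    hη2 heT2 heT3

namespace IsAirySetup

variable {u v u' v' : ℝ → ℝ} {ta1 c0 : ℝ}

lemma exists_estimate_of_large (h : IsAirySetup u v u' v' ta1 c0) :
    ∃ C, 0 ≤ C ∧ ∀ a x : ℝ, 0 < a → c0 + 1 ≤ a ^ 2 → -c0 ≤ x → x < -ta1 →
      v (a ^ 2 + x) * u' x = u (a ^ 2 + x) * v' x →
      |-ta1 - x - √3 * airyAlpha * u' (-ta1) ^ 2 / ta1 * exp (-(4/3) * a ^ 3 + 2 * ta1 * a)| ≤
        C / a * exp (-(4/3) * a ^ 3 + 2 * ta1 * a) := by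
  have ht := h.ta1_pos
  have hc := h.c0_pos
  have hu := h.u'_pos (x := -ta1) (by linarith [h.ta1_lt_c0]) (by linarith)
  have hα := airyAlpha_pos
  obtain ⟨K, hK, hest⟩ := exists_exponential_estimate (L := √3 * airyAlpha) (k := c0) (t := ta1)
    (by positivity) hc.le
  obtain ⟨M, hM, htay⟩ := h.exists_taylor_bound
  set κ := ta1 / u' (-ta1) ^ 2 with hκ
  have hκ0 : 0 < κ := by positivity
  refine ⟨(K + M * K) / κ, by positivity, fun a x ha ha2 hx hxt heq => ?_⟩
  set T := exp (-(4/3) * a ^ 3 + 2 * ta1 * a)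
  have hy : 1 ≤ a ^ 2 + x := by linarith
  set b := √(a ^ 2 + x) with hb
  have hb2 : b ^ 2 = a ^ 2 + x := sq_sqrt (by linarith)
  have hd := h.abs_airyAlpha_sub_div_sub_le hy
  have hx0 : x < 0 := by linarith
  rw [← sub_eq_zero.1 ((h.eq_iff_div_eq hx hx0 (by linarith)).1 heq)] at hd
  have hle := h.le_airyAlpha_sub hx hxt
  have htx := htay x hx hxt
  set d := airyAlpha - v' x / u' x
  set η := -ta1 - x with hη
  have hη0 : 0 ≤ η := by linarith
  obtain ⟨h1, h2⟩ := hest a b η d (one_le_sqrt.2 hy)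
    (sqrt_le_iff.2 ⟨ha.le, by linarith⟩) (by linarith) (by linarith) hη0 hle hd
  have h3 : M * η ^ 2 ≤ M * K / a * T := by
    calc M * η ^ 2 = M * (η * η) := by ring
      _ ≤ M * (η * d) := by gcongr
      _ ≤ M * (K / a * T) := by gcongr
      _ = _ := by ring
  have e : η - √3 * airyAlpha * u' (-ta1) ^ 2 / ta1 * T
      = ((d - √3 * airyAlpha * T) - (d - κ * η)) / κ := by
    rw [hκ]; field_simp; ring
  rw [e, abs_div, abs_of_pos hκ0, div_le_iff₀ hκ0]
  calc _ ≤ |d - √3 * airyAlpha * T| + |d - κ * η| := abs_sub _ _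
    _ ≤ K / a * T + M * K / a * T := add_le_add h1 (htx.trans h3)
    _ = _ := by field_simp

lemma exists_estimate (h : IsAirySetup u v u' v' ta1 c0) :
    ∃ C, 0 < C ∧ ∀ a x : ℝ, 0 < a → -c0 ≤ x → x < -ta1 →
      v (a ^ 2 + x) * u' x = u (a ^ 2 + x) * v' x →
      |-ta1 - x - √3 * airyAlpha * u' (-ta1) ^ 2 / ta1 * exp (-(4/3) * a ^ 3 + 2 * ta1 * a)| ≤
        C / a * exp (-(4/3) * a ^ 3 + 2 * ta1 * a) := by
  obtain ⟨C, hC, hlarge⟩ := h.exists_estimate_of_large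
  have ht := h.ta1_pos
  have hc := h.c0_pos
  have hu := h.u'_pos (x := -ta1) (by linarith [h.ta1_lt_c0]) (by linarith)
  have hα := airyAlpha_pos
  set N := √3 * airyAlpha * u' (-ta1) ^ 2 / ta1 with hN
  have hN0 : 0 < N := by positivity
  set D := (1 + c0) * (c0 * exp (4/3 * (1 + c0) ^ 3) + N) with hD
  have hD0 : 0 < D := by positivity
  refine ⟨C + D, by positivity, fun a x ha hx hxt heq => ?_⟩
  set T := exp (-(4/3) * a ^ 3 + 2 * ta1 * a) with hT
  have hT0 : 0 < T := exp_pos _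
  rcases le_total (c0 + 1) (a ^ 2) with ha2 | ha2
  · refine (hlarge a x ha ha2 hx hxt heq).trans ?_
    gcongr
    linarith
  · have ha1 : a ≤ 1 + c0 := by nlinarith
    have hTlow : 1 ≤ exp (4/3 * (1 + c0) ^ 3) * T := by
      rw [hT, ← exp_add]
      refine one_le_exp ?_
      have : a ^ 3 ≤ (1 + c0) ^ 3 := by gcongr
      have : 0 ≤ ta1 * a := by positivity
      linarith
    have h1 : |-ta1 - x - N * T| ≤ c0 + N * T := by
      have : 0 < N * T := by positivity
      rw [abs_le]
      constructor <;> linarith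
    calc _ ≤ c0 + N * T := h1
      _ ≤ c0 * (exp (4/3 * (1 + c0) ^ 3) * T) + N * T := by
          gcongr
          exact le_mul_of_one_le_right hc.le hTlow
      _ = D / (1 + c0) * T := by rw [hD]; field_simp
      _ ≤ (C + D) / a * T := by
          gcongr
          linarith

end IsAirySetup

theorem stmt_9 (u v u' v' : ℝ → ℝ)
    (hu : ∀ x, HasDerivAt u (u' x) x)
    (huAiry : ∀ x, HasDerivAt u' (x * u x) x)
    (hv : ∀ x, HasDerivAt v (v' x) x)
    (hvAiry : ∀ x, HasDerivAt v' (x * v x) x)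
    (hu0 : u 0 = 1) (hu'0 : u' 0 = 0) (hv0 : v 0 = 0) (hv'0 : v' 0 = 1)
    (ta1 : ℝ) (hta1pos : 0 < ta1)
    (hta1z : AiD u' v' (-ta1) = 0)
    (hta1ne : ∀ x : ℝ, -ta1 < x → AiD u' v' x ≠ 0)
    (c0 : ℝ) (hc0pos : 0 < c0)
    (hc0z : v' (-c0) = 0)
    (hc0ne : ∀ x : ℝ, -c0 < x → v' x ≠ 0) :
    -- (1) existence, uniqueness and first estimates for E⁰_max
    (∀ c : ℝ, c0 < c →
      (∃! E : ℝ, E ≤ 0 ∧ -c0 ≤ -c - E ∧ -c - E < -ta1 ∧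
        v (-E) * u' (-c - E) = u (-E) * v' (-c - E)) ∧
      (∀ E : ℝ, (E ≤ 0 ∧ -c0 ≤ -c - E ∧ -c - E < -ta1 ∧
          v (-E) * u' (-c - E) = u (-E) * v' (-c - E)) →
        -c + ta1 < E ∧ E < -c + c0)) ∧
    -- (2) semiclassical estimate for E⁰_max
    (∃ C : ℝ, 0 < C ∧
      ∀ h : ℝ, h ∈ Ioo (0:ℝ) (c0 ^ (-(3:ℝ)/2)) →
        ∀ E : ℝ,
          E ≤ 0 → -c0 ≤ -(h ^ (-(2:ℝ)/3)) - E → -(h ^ (-(2:ℝ)/3)) - E < -ta1 →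
          v (-E) * u' (-(h ^ (-(2:ℝ)/3)) - E)
            = u (-E) * v' (-(h ^ (-(2:ℝ)/3)) - E) →
          |E + h ^ (-(2:ℝ)/3) - ta1
              - Real.sqrt 3 * airyAlpha * (u' (-ta1)) ^ 2 / ta1
                * Real.exp (-4/(3*h) + 2 * ta1 * h ^ (-(1:ℝ)/3))|
            ≤ C * h ^ ((1:ℝ)/3) * Real.exp (-4/(3*h) + 2 * ta1 * h ^ (-(1:ℝ)/3))) := by
  have H : IsAirySetup u v u' v' ta1 c0 :=
    { hasDerivAt_u := hu, hasDerivAt_u' := huAiry, hasDerivAt_v := hv, hasDerivAt_v' := hvAiry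
      u_zero := hu0, u'_zero := hu'0, v_zero := hv0, v'_zero := hv'0
      ta1_pos := hta1pos, AiD_ta1 := hta1z, AiD_ne_zero := hta1ne
      c0_pos := hc0pos, v'_c0 := hc0z, v'_ne_zero := hc0ne }
  refine ⟨fun c hc => ⟨?_, ?_⟩, ?_⟩
  · obtain ⟨x, ⟨hx1, hx2, hx3⟩, hun⟩ := H.existsUnique_matching hc
    refine ⟨-c - x, ⟨by linarith, by linarith, by linarith, ?_⟩, ?_⟩
    · rwa [show -(-c - x) = c + x by ring, show -c - (-c - x) = x by ring]
    · rintro E ⟨-, h1, h2, h3⟩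
      have := hun (-c - E) ⟨h1, h2, by rwa [show c + (-c - E) = -E by ring]⟩
      linarith
  · rintro E ⟨-, h1, h2, h3⟩
    refine ⟨by linarith, lt_of_le_of_ne (by linarith) fun he => ?_⟩
    have hpos := H.v_pos (x := -E) (by linarith)
    have hu'pos := H.u'_pos le_rfl (neg_lt_zero.2 hc0pos)
    rw [show -c - E = -c0 by linarith, hc0z, mul_zero] at h3
    exact (mul_pos hpos hu'pos).ne' h3
  · obtain ⟨C, hC, hest⟩ := H.exists_estimate
    refine ⟨C, hC, fun h hh E _ h1 h2 h3 => ?_⟩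
    have hh0 : 0 < h := hh.1
    set a := h ^ (-(1:ℝ)/3) with ha
    have ha0 : 0 < a := rpow_pos_of_pos hh0 _
    have e2 : h ^ (-(2:ℝ)/3) = a ^ 2 := by
      rw [ha, ← rpow_natCast, ← rpow_mul hh0.le]; norm_num
    have e1 : h ^ ((1:ℝ)/3) = 1 / a := by
      rw [ha, one_div (h ^ (-(1:ℝ)/3)), ← rpow_neg hh0.le]; norm_num
    have e3 : -4 / (3 * h) = -(4/3) * a ^ 3 := by
      have : a ^ 3 = h⁻¹ := by
        rw [ha, ← rpow_natCast, ← rpow_mul hh0.le, ← rpow_neg_one]; norm_num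
      rw [this]; field_simp
    rw [e2] at h1 h2 h3 ⊢
    rw [e1, e3]
    have := hest a (-a ^ 2 - E) ha0 h1 h2 (by rwa [show a ^ 2 + (-a ^ 2 - E) = -E by ring])
    rw [show -ta1 - (-a ^ 2 - E) = E + a ^ 2 - ta1 by ring] at this
    rwa [mul_one_div]
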